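/- arXiv:2103.06436 — 3 statements merged into one kernel-verified Lean document; each statement's English description precedes it below -/
import Mathlib

section
/- For 0 < r ≤ R, the cross-term integral satisfies 2Rr ∫₀^∞ J₁(Rt)J₁(rt) t^{-2} dt = (4R³/(3π)) ( (1 + r²/R²) E(r/R) − (1 − r²/R²) K(r/R) ). -/
noncomputable def ellK (w : ℝ) : ℝ := ∫ θ in (0:ℝ)..(Real.pi/2), 1 / Real.sqrt (1 - w^2 * Real.sin θ ^ 2)

noncomputable def ellE (w : ℝ) : ℝ := ∫ θ in (0:ℝ)..(Real.pi/2), Real.sqrt (1 - w^2 * Real.sin θ ^ 2)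

noncomputable def Gfun (w : ℝ) : ℝ := 1 + w^3 + (1 - w^2) * ellK w - (1 + w^2) * ellE w

noncomputable def besselJ1 (x : ℝ) : ℝ := (1 / Real.pi) * ∫ θ in (0:ℝ)..Real.pi, Real.cos (θ - x * Real.sin θ)

open MeasureTheory Filter Topology

theorem aux_t (s : ℝ) (hs : 0 < s) :
    IntegrableOn (fun t => s * Real.exp (-(s * t)) * (1 - Real.cos t)) (Set.Ioi 0) ∧
    ∫ t in Set.Ioi (0:ℝ), s * Real.exp (-(s * t)) * (1 - Real.cos t) = (1 + s^2)⁻¹ := by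
  have hpos : (0:ℝ) < 1 + s^2 := by positivity
  set G : ℝ → ℝ := fun t => - Real.exp (-(s*t)) *
    (1 + s * (Real.sin t - s * Real.cos t) / (1+s^2)) with hG
  have hd : ∀ x ∈ Set.Ici (0:ℝ), HasDerivAt G (s * Real.exp (-(s * x)) * (1 - Real.cos x)) x := by
    intro x _
    have h1 : HasDerivAt (fun t => - Real.exp (-(s*t))) (-(Real.exp (-(s*x)) * (-(s*1)))) x :=
      (((hasDerivAt_id x).const_mul s).neg.exp).neg
    have h2 : HasDerivAt (fun t => 1 + s * (Real.sin t - s * Real.cos t) / (1+s^2))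
        (s * (Real.cos x - s * (-Real.sin x)) / (1+s^2)) x :=
      ((((Real.hasDerivAt_sin x).sub ((Real.hasDerivAt_cos x).const_mul s)).const_mul s).div_const _).const_add 1
    have h3 : HasDerivAt G _ x := h1.mul h2
    refine h3.congr_deriv ?_
    field_simp
    ring
  have hn : ∀ x ∈ Set.Ioi (0:ℝ), 0 ≤ s * Real.exp (-(s * x)) * (1 - Real.cos x) := by
    intro x _
    have := Real.cos_le_one x
    have : 0 ≤ 1 - Real.cos x := by linarith
    positivity
  have hlim : Tendsto G atTop (𝓝 0) := by
    have h1 : Tendsto (fun t => - Real.exp (-(s*t))) atTop (𝓝 0) := by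
      have : Tendsto (fun t : ℝ => s * t) atTop atTop := tendsto_id.const_mul_atTop hs
      simpa using (Real.tendsto_exp_neg_atTop_nhds_zero.comp this).neg
    refine h1.zero_mul_isBoundedUnder_le ?_
    refine isBoundedUnder_of ⟨1 + s * (1 + s) / (1+s^2), fun t => ?_⟩
    have a1 := Real.abs_sin_le_one t
    have a2 := Real.abs_cos_le_one t
    simp only [Function.comp, Real.norm_eq_abs]
    refine (abs_add_le _ _).trans ?_
    rw [abs_div, abs_mul, abs_of_pos hs, abs_of_pos hpos, abs_one]
    have : |Real.sin t - s * Real.cos t| ≤ 1 + s := by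
      refine (abs_sub _ _).trans ?_
      rw [abs_mul, abs_of_pos hs]
      nlinarith
    gcongr
  refine ⟨integrableOn_Ioi_deriv_of_nonneg' hd hn hlim, ?_⟩
  rw [integral_Ioi_of_hasDerivAt_of_nonneg' hd hn hlim]
  simp [hG]
  field_simp
  ring

theorem aux_s (t : ℝ) (ht : 0 < t) :
    ∫ s in Set.Ioi (0:ℝ), s * Real.exp (-(s * t)) * (1 - Real.cos t) = (1 - Real.cos t) / t^2 := by
  rw [integral_mul_const]
  have := Real.integral_rpow_mul_exp_neg_mul_Ioi (a := 2) (r := t) (by norm_num) ht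
  have h2 : ∫ s in Set.Ioi (0:ℝ), s * Real.exp (-(s * t)) = 1 / t^2 := by
    convert this using 1
    · refine setIntegral_congr_fun measurableSet_Ioi fun s _ => ?_
      norm_num [mul_comm]
    · norm_num
  rw [h2]; ring

theorem one_sub_cos_int :
    IntegrableOn (fun t => (1 - Real.cos t) / t^2) (Set.Ioi 0) ∧
    ∫ t in Set.Ioi (0:ℝ), (1 - Real.cos t) / t^2 = Real.pi / 2 := by
  have hint : Integrable (Function.uncurry fun s t : ℝ => s * Real.exp (-(s * t)) * (1 - Real.cos t))
      ((volume.restrict (Set.Ioi 0)).prod (volume.restrict (Set.Ioi 0))) := by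
    rw [integrable_prod_iff]
    · constructor
      · filter_upwards [ae_restrict_mem measurableSet_Ioi] with s hs
        exact (aux_t s hs).1
      · have : IntegrableOn (fun s : ℝ => (1 + s^2)⁻¹) (Set.Ioi 0) := integrable_inv_one_add_sq.integrableOn
        refine this.congr ?_
        filter_upwards [ae_restrict_mem measurableSet_Ioi] with s hs
        rw [← (aux_t s hs).2]
        refine setIntegral_congr_fun measurableSet_Ioi fun t _ => ?_
        have hs' : (0:ℝ) < s := hs
        have : 0 ≤ 1 - Real.cos t := by linarith [Real.cos_le_one t]
        simp only [Function.uncurry]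
        rw [Real.norm_of_nonneg (by positivity)]
    · apply Continuous.aestronglyMeasurable
      unfold Function.uncurry
      fun_prop
  constructor
  · refine hint.integral_prod_right.congr ?_
    filter_upwards [ae_restrict_mem measurableSet_Ioi] with t ht
    exact aux_s t ht
  · have := integral_integral_swap hint
    rw [← setIntegral_congr_fun measurableSet_Ioi fun t ht => aux_s t ht, ← this,
      setIntegral_congr_fun measurableSet_Ioi fun s hs => (aux_t s hs).2]
    simp

theorem one_sub_cos_int_scale (c : ℝ) :
    IntegrableOn (fun t => (1 - Real.cos (c * t)) / t^2) (Set.Ioi 0) ∧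
    ∫ t in Set.Ioi (0:ℝ), (1 - Real.cos (c * t)) / t^2 = Real.pi / 2 * |c| := by
  rcases eq_or_ne c 0 with rfl | hc
  · simp
  have hc' : 0 < |c| := abs_pos.mpr hc
  have key : (fun t : ℝ => (1 - Real.cos (c * t)) / t^2) =
      fun t => |c|^2 * ((fun u => (1 - Real.cos u) / u^2) (|c| * t)) := by
    funext t
    have : Real.cos (|c| * t) = Real.cos (c * t) := by
      rcases abs_choice c with h | h <;> rw [h]
      rw [neg_mul, Real.cos_neg]
    simp only [this]
    rcases eq_or_ne t 0 with rfl | ht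
    · simp
    · field_simp
  rw [key]
  constructor
  · apply Integrable.const_mul
    have := (integrableOn_Ioi_comp_mul_left_iff (fun u => (1 - Real.cos u) / u^2) 0 hc').mpr
      (by simpa using one_sub_cos_int.1)
    exact this
  · rw [integral_const_mul, integral_comp_mul_left_Ioi (fun u => (1 - Real.cos u) / u^2) _ hc', mul_zero, one_sub_cos_int.2, smul_eq_mul]
    field_simp

theorem sin_sin_int (A B : ℝ) (hA : 0 ≤ A) (hB : 0 ≤ B) :
    ∫ t in Set.Ioi (0:ℝ), Real.sin (A * t) * Real.sin (B * t) / t^2 = Real.pi / 2 * min A B := by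
  have h1 := one_sub_cos_int_scale (A + B)
  have h2 := one_sub_cos_int_scale (A - B)
  have : ∀ t : ℝ, Real.sin (A * t) * Real.sin (B * t) / t^2 =
      (1/2) * ((1 - Real.cos ((A + B) * t)) / t^2 - (1 - Real.cos ((A - B) * t)) / t^2) := by
    intro t
    rw [add_mul, sub_mul, Real.cos_add, Real.cos_sub]
    ring
  simp_rw [this]
  rw [integral_const_mul, integral_sub h1.1 h2.1, h1.2, h2.2, abs_of_nonneg (by positivity : 0 ≤ A + B)]
  rcases le_total A B with h | h
  · rw [min_eq_left h, abs_of_nonpos (by linarith)]; ring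
  · rw [min_eq_right h, abs_of_nonneg (by linarith)]; ring

theorem half_sin (f : ℝ → ℝ) (hf : Continuous fun θ => f (Real.sin θ)) :
    ∫ θ in (0:ℝ)..Real.pi, f (Real.sin θ) = 2 * ∫ θ in (0:ℝ)..(Real.pi/2), f (Real.sin θ) := by
  rw [← intervalIntegral.integral_add_adjacent_intervals (b := Real.pi/2)
    (hf.intervalIntegrable _ _) (hf.intervalIntegrable _ _)]
  have := intervalIntegral.integral_comp_sub_left (a := 0) (b := Real.pi/2)
    (fun θ => f (Real.sin θ)) Real.pi
  simp only [Real.sin_pi_sub, sub_zero] at this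
  rw [show Real.pi - Real.pi/2 = Real.pi/2 by ring] at this
  rw [← this]; ring

theorem besselJ1_eq (x : ℝ) :
    besselJ1 x = (1 / Real.pi) * ∫ θ in (0:ℝ)..Real.pi, Real.sin θ * Real.sin (x * Real.sin θ) := by
  unfold besselJ1
  congr 1
  simp_rw [Real.cos_sub]
  rw [intervalIntegral.integral_add
    (Continuous.intervalIntegrable (by fun_prop) _ _) (Continuous.intervalIntegrable (by fun_prop) _ _)]
  have := intervalIntegral.integral_comp_sub_left (a := 0) (b := Real.pi)
    (fun θ => Real.cos θ * Real.cos (x * Real.sin θ)) Real.pi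
  simp only [Real.sin_pi_sub, Real.cos_pi_sub, sub_zero, sub_self, neg_mul,
    intervalIntegral.integral_neg] at this
  linarith

theorem bound_aux (A B a b t R r : ℝ) (hR : 0 ≤ R) (hr : 0 ≤ r) (ht : 0 < t) (ha : |a| ≤ 1) (hb : |b| ≤ 1)
    (hA : A = R * a) (hB : B = r * b) :
    ‖a * b * (Real.sin (A * t) * Real.sin (B * t) / t^2)‖ ≤ (R * r + 1) * (1 + t^2)⁻¹ := by
  have h1 : |Real.sin (A * t)| ≤ R * t := by
    refine Real.abs_sin_le_abs.trans ?_
    rw [hA, abs_mul, abs_mul, abs_of_nonneg hR, abs_of_pos ht]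
    have : R * |a| ≤ R * 1 := by gcongr
    nlinarith
  have h2 : |Real.sin (B * t)| ≤ r * t := by
    refine Real.abs_sin_le_abs.trans ?_
    rw [hB, abs_mul, abs_mul, abs_of_nonneg hr, abs_of_pos ht]
    have : r * |b| ≤ r * 1 := by gcongr
    nlinarith
  have h3 := Real.abs_sin_le_one (A * t)
  have h4 := Real.abs_sin_le_one (B * t)
  rw [Real.norm_eq_abs, abs_mul, abs_mul, abs_div, abs_mul, abs_of_nonneg (sq_nonneg t)]
  have hab : |a| * |b| ≤ 1 := mul_le_one₀ ha (abs_nonneg _) hb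
  set p := |Real.sin (A * t)|
  set q := |Real.sin (B * t)|
  have hp : 0 ≤ p := abs_nonneg _
  have hq : 0 ≤ q := abs_nonneg _
  have e1 : p * q ≤ (R * t) * (r * t) := by gcongr
  have e2 : p * q ≤ 1 := mul_le_one₀ h3 hq h4
  have : p * q / t^2 ≤ (R * r + 1) * (1 + t^2)⁻¹ := by
    rw [← div_eq_mul_inv, div_le_div_iff₀ (by positivity) (by positivity)]
    nlinarith [sq_nonneg t]
  calc _ ≤ 1 * (p * q / t^2) := by gcongr
    _ ≤ _ := by rwa [one_mul]

theorem fubini_step (r R : ℝ) (hr : 0 < r) (hR : 0 < R) :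
    ∫ t in Set.Ioi (0:ℝ), besselJ1 (R * t) * besselJ1 (r * t) / t ^ 2 =
      1 / (2 * Real.pi) * ∫ φ in (0:ℝ)..Real.pi, ∫ θ in (0:ℝ)..Real.pi,
        Real.sin φ * Real.sin θ * min (R * Real.sin θ) (r * Real.sin φ) := by
  set ν : Measure ℝ := volume.restrict (Set.Ioc 0 Real.pi) with hν
  set F : (ℝ × ℝ) → ℝ → ℝ := fun p t => Real.sin p.1 * Real.sin p.2 *
    (Real.sin (r * Real.sin p.1 * t) * Real.sin (R * Real.sin p.2 * t) / t^2) with hF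
  have hint : Integrable (Function.uncurry F) ((ν.prod ν).prod (volume.restrict (Set.Ioi 0))) := by
    have hg : Integrable (fun t : ℝ => (r * R + 1) * (1 + t^2)⁻¹) (volume.restrict (Set.Ioi 0)) :=
      (integrable_inv_one_add_sq.const_mul _).integrableOn
    refine (hg.comp_snd (ν.prod ν)).mono' ?_ ?_
    · apply Measurable.aestronglyMeasurable
      simp only [hF, Function.uncurry_def]
      fun_prop
    · have : ∀ᵐ z ∂((ν.prod ν).prod (volume.restrict (Set.Ioi (0:ℝ)))), z.2 ∈ Set.Ioi (0:ℝ) :=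
        Measure.quasiMeasurePreserving_snd.ae (ae_restrict_mem measurableSet_Ioi)
      filter_upwards [this] with z hz
      exact bound_aux _ _ _ _ z.2 r R hr.le hR.le hz (Real.abs_sin_le_one _) (Real.abs_sin_le_one _) rfl rfl
  have hsw := integral_integral_swap hint
  have h1 : ∀ t : ℝ, besselJ1 (R * t) * besselJ1 (r * t) / t ^ 2 =
      1 / Real.pi^2 * ∫ p, F p t ∂(ν.prod ν) := by
    intro t
    have e : ∀ p : ℝ × ℝ, F p t = (Real.sin p.1 * Real.sin (r * t * Real.sin p.1)) *
        (Real.sin p.2 * Real.sin (R * t * Real.sin p.2)) * (1 / t^2) := by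
      intro p
      simp only [hF]
      rw [mul_right_comm r, mul_right_comm R]; ring
    simp_rw [e]
    rw [integral_mul_const, integral_prod_mul (fun x => Real.sin x * Real.sin (r * t * Real.sin x))
      (fun x => Real.sin x * Real.sin (R * t * Real.sin x)), besselJ1_eq, besselJ1_eq,
      intervalIntegral.integral_of_le Real.pi_pos.le, intervalIntegral.integral_of_le Real.pi_pos.le]
    ring
  simp_rw [h1]
  rw [integral_const_mul, ← hsw]
  have hnn : ∀ᵐ x ∂ν, 0 ≤ Real.sin x := by
    filter_upwards [ae_restrict_mem measurableSet_Ioc] with x hx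
    exact Real.sin_nonneg_of_nonneg_of_le_pi hx.1.le hx.2
  have hcongr : ∫ p, (∫ t in Set.Ioi 0, F p t) ∂(ν.prod ν) = ∫ p : ℝ × ℝ,
      Real.pi / 2 * (Real.sin p.1 * Real.sin p.2 * min (R * Real.sin p.2) (r * Real.sin p.1)) ∂(ν.prod ν) := by
    refine integral_congr_ae ?_
    have a1 : ∀ᵐ z ∂(ν.prod ν), 0 ≤ Real.sin z.1 := Measure.quasiMeasurePreserving_fst.ae hnn
    have a2 : ∀ᵐ z ∂(ν.prod ν), 0 ≤ Real.sin z.2 := Measure.quasiMeasurePreserving_snd.ae hnn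
    filter_upwards [a1, a2] with p hp1 hp2
    simp only [hF]
    rw [integral_const_mul, sin_sin_int _ _ (by positivity) (by positivity), min_comm]
    ring
  rw [hcongr, integral_const_mul, integral_prod]
  · rw [intervalIntegral.integral_of_le Real.pi_pos.le]
    simp_rw [intervalIntegral.integral_of_le Real.pi_pos.le]
    rw [← hν]
    have := Real.pi_ne_zero
    rw [← mul_assoc]
    congr 1
    field_simp
  · have hcont : Continuous fun p : ℝ × ℝ =>
        Real.sin p.1 * Real.sin p.2 * min (R * Real.sin p.2) (r * Real.sin p.1) := by fun_prop
    rw [hν, Measure.prod_restrict]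
    exact (hcont.continuousOn.integrableOn_compact (isCompact_Icc.prod isCompact_Icc)).mono_set
      (Set.prod_mono Set.Ioc_subset_Icc_self Set.Ioc_subset_Icc_self)

theorem inner_int (b : ℝ) (hb0 : 0 ≤ b) (hb1 : b ≤ 1) :
    ∫ θ in (0:ℝ)..Real.pi, Real.sin θ * min (Real.sin θ) b =
      Real.arcsin b + b * Real.sqrt (1 - b^2) := by
  rw [half_sin (fun s => s * min s b) (by fun_prop)]
  have hα0 : 0 ≤ Real.arcsin b := Real.arcsin_nonneg.mpr hb0
  have hα1 : Real.arcsin b ≤ Real.pi / 2 := Real.arcsin_le_pi_div_two b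
  have hsin : Real.sin (Real.arcsin b) = b := Real.sin_arcsin (by linarith) hb1
  have hc : Continuous fun θ => Real.sin θ * min (Real.sin θ) b := by fun_prop
  rw [← intervalIntegral.integral_add_adjacent_intervals (b := Real.arcsin b)
    (hc.intervalIntegrable _ _) (hc.intervalIntegrable _ _)]
  have e1 : ∫ θ in (0:ℝ)..(Real.arcsin b), Real.sin θ * min (Real.sin θ) b =
      ∫ θ in (0:ℝ)..(Real.arcsin b), Real.sin θ ^ 2 := by
    refine intervalIntegral.integral_congr fun θ hθ => ?_
    rw [Set.uIcc_of_le hα0] at hθ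
    have : Real.sin θ ≤ b := by
      rw [← hsin]
      exact Real.sin_le_sin_of_le_of_le_pi_div_two (by linarith [hθ.1, Real.pi_pos]) hα1 hθ.2
    rw [min_eq_left this]; ring
  have e2 : ∫ θ in (Real.arcsin b)..(Real.pi/2), Real.sin θ * min (Real.sin θ) b =
      ∫ θ in (Real.arcsin b)..(Real.pi/2), Real.sin θ * b := by
    refine intervalIntegral.integral_congr fun θ hθ => ?_
    rw [Set.uIcc_of_le hα1] at hθ
    have : b ≤ Real.sin θ := by
      rw [← hsin]
      exact Real.sin_le_sin_of_le_of_le_pi_div_two (by linarith [hθ.1, Real.pi_pos]) hθ.2 hθ.1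
    rw [min_eq_right this]
  rw [e1, e2, integral_sin_sq, intervalIntegral.integral_mul_const, integral_sin, hsin,
    Real.cos_arcsin]
  simp
  ring

theorem delta_pos (w x : ℝ) (hw0 : 0 < w) (hw1 : w ≤ 1) (hx : x ∈ Set.Ioo 0 (Real.pi/2)) :
    0 < 1 - w^2 * Real.sin x ^ 2 := by
  have hc : 0 < Real.cos x := Real.cos_pos_of_mem_Ioo ⟨by linarith [hx.1, Real.pi_pos], hx.2⟩
  have := Real.sin_sq_add_cos_sq x
  have hw2 : w^2 ≤ 1 := by nlinarith
  nlinarith [sq_nonneg (Real.sin x), mul_pos hc hc]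

theorem C_integrable (w : ℝ) (hw0 : 0 < w) (hw1 : w ≤ 1) :
    IntervalIntegrable (fun φ => Real.cos φ ^ 2 / Real.sqrt (1 - w^2 * Real.sin φ ^ 2)) volume 0 (Real.pi/2) := by
  have h1 : IntervalIntegrable (fun _ : ℝ => (1:ℝ)) volume 0 (Real.pi/2) := intervalIntegrable_const
  refine h1.mono_fun' ?_ ?_
  · apply Measurable.aestronglyMeasurable
    fun_prop
  · refine Eventually.of_forall fun x => ?_
    have hcs := Real.sin_sq_add_cos_sq x
    have hw2 : w^2 ≤ 1 := by nlinarith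
    have h0 : Real.cos x ^ 2 ≤ 1 - w^2 * Real.sin x ^ 2 := by nlinarith [sq_nonneg (Real.sin x)]
    have h3 : |Real.cos x| ≤ Real.sqrt (1 - w^2 * Real.sin x ^ 2) := Real.abs_le_sqrt h0
    have h2 := Real.abs_cos_le_one x
    beta_reduce
    rw [Real.norm_of_nonneg (by positivity)]
    refine div_le_one_of_le₀ ?_ (Real.sqrt_nonneg _)
    rw [← sq_abs]
    nlinarith [abs_nonneg (Real.cos x)]

theorem C_eq (w : ℝ) (hw0 : 0 < w) (hw1 : w ≤ 1) :
    w^2 * ∫ φ in (0:ℝ)..(Real.pi/2), Real.cos φ ^ 2 / Real.sqrt (1 - w^2 * Real.sin φ ^ 2) =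
      ellE w - (1 - w^2) * ellK w := by
  unfold ellE ellK
  rw [← intervalIntegral.integral_const_mul, ← intervalIntegral.integral_const_mul,
    ← intervalIntegral.integral_sub]
  · refine intervalIntegral.integral_congr fun x _ => ?_
    have hcs := Real.sin_sq_add_cos_sq x
    have hw2 : w^2 ≤ 1 := by nlinarith
    have h0 : Real.cos x ^ 2 ≤ 1 - w^2 * Real.sin x ^ 2 := by nlinarith [sq_nonneg (Real.sin x)]
    have hnn : 0 ≤ 1 - w^2 * Real.sin x ^ 2 := (sq_nonneg _).trans h0
    have hsq := Real.sq_sqrt hnn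
    set D := Real.sqrt (1 - w^2 * Real.sin x ^ 2)
    rcases eq_or_ne D 0 with h | h
    · simp [h]
    · field_simp
      rw [hsq]
      linear_combination w^2 * hcs
  · exact Continuous.intervalIntegrable (by fun_prop) _ _
  · rcases hw1.lt_or_eq with h | h
    · apply ContinuousOn.intervalIntegrable
      have : ∀ x, Real.sqrt (1 - w^2 * Real.sin x ^ 2) ≠ 0 := by
        intro x
        have : 0 < 1 - w^2 * Real.sin x ^ 2 := by
          nlinarith [Real.sin_sq_le_one x, sq_nonneg (Real.sin x)]
        positivity
      apply Continuous.continuousOn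
      exact continuous_const.mul (continuous_const.div (by fun_prop) this)
    · subst h; simp

theorem arcsin_part (w : ℝ) (hw0 : 0 < w) (hw1 : w ≤ 1) :
    ∫ φ in (0:ℝ)..(Real.pi/2), Real.sin φ * Real.arcsin (w * Real.sin φ) =
      w * ∫ φ in (0:ℝ)..(Real.pi/2), Real.cos φ ^ 2 / Real.sqrt (1 - w^2 * Real.sin φ ^ 2) := by
  have hc : Continuous fun φ => Real.sin φ * Real.arcsin (w * Real.sin φ) := by
    have := Real.continuous_arcsin
    fun_prop
  have hi := (hc.intervalIntegrable (μ := volume) 0 (Real.pi/2)).sub ((C_integrable w hw0 hw1).const_mul w)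
  have key := intervalIntegral.integral_eq_sub_of_hasDerivAt_of_le
    (f := fun φ => - Real.cos φ * Real.arcsin (w * Real.sin φ)) (a := 0) (b := Real.pi/2)
    (by positivity) ?_ ?_ hi
  · rw [intervalIntegral.integral_sub (hc.intervalIntegrable _ _) ((C_integrable w hw0 hw1).const_mul w),
      intervalIntegral.integral_const_mul] at key
    simp at key
    linarith
  · have := Real.continuous_arcsin
    fun_prop
  · intro x hx
    have hD := delta_pos w x hw0 hw1 hx
    have hs : 0 < Real.sin x := Real.sin_pos_of_pos_of_lt_pi hx.1 (by linarith [hx.2, Real.pi_pos])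
    have hlt : w * Real.sin x < 1 := by nlinarith [mul_pos hw0 hs]
    have h1 := (Real.hasDerivAt_arcsin (x := w * Real.sin x) (by nlinarith [mul_pos hw0 hs]) hlt.ne).comp x
      ((Real.hasDerivAt_sin x).const_mul w)
    have h2 := ((Real.hasDerivAt_cos x).neg).mul h1
    refine h2.congr_deriv ?_
    simp only [Function.comp, Pi.neg_apply, mul_pow]
    ring

theorem sinsq_part (w : ℝ) (hw0 : 0 < w) (hw1 : w ≤ 1) :
    3 * ∫ φ in (0:ℝ)..(Real.pi/2), Real.sin φ ^ 2 * Real.sqrt (1 - w^2 * Real.sin φ ^ 2) =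
      2 * ellE w - ∫ φ in (0:ℝ)..(Real.pi/2), Real.cos φ ^ 2 / Real.sqrt (1 - w^2 * Real.sin φ ^ 2) := by
  have i1 : IntervalIntegrable (fun φ => 2 * Real.sqrt (1 - w^2 * Real.sin φ ^ 2)) volume 0 (Real.pi/2) :=
    Continuous.intervalIntegrable (by fun_prop) _ _
  have i2 : IntervalIntegrable (fun φ => 3 * (Real.sin φ ^ 2 * Real.sqrt (1 - w^2 * Real.sin φ ^ 2)))
      volume 0 (Real.pi/2) :=
    Continuous.intervalIntegrable (by fun_prop) _ _
  have i3 := C_integrable w hw0 hw1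
  have key := intervalIntegral.integral_eq_sub_of_hasDerivAt_of_le
    (f := fun φ => Real.sin φ * Real.cos φ * Real.sqrt (1 - w^2 * Real.sin φ ^ 2)) (a := 0) (b := Real.pi/2)
    (by positivity) (by fun_prop) ?_ ((i1.sub i2).sub i3)
  · rw [intervalIntegral.integral_sub (i1.sub i2) i3, intervalIntegral.integral_sub i1 i2,
      intervalIntegral.integral_const_mul, intervalIntegral.integral_const_mul] at key
    simp at key
    unfold ellE
    linarith
  · intro x hx
    have hD := delta_pos w x hw0 hw1 hx
    have h1 : HasDerivAt (fun φ => 1 - w^2 * Real.sin φ ^ 2)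
        (-(w^2 * (2 * Real.sin x * Real.cos x))) x := by
      have := (((Real.hasDerivAt_sin x).pow 2).const_mul (w^2)).const_sub 1
      refine this.congr_deriv ?_
      simp
    have h2 := ((Real.hasDerivAt_sin x).mul (Real.hasDerivAt_cos x)).mul (h1.sqrt hD.ne')
    refine h2.congr_deriv ?_
    have hsq := Real.sq_sqrt hD.le
    have hne : Real.sqrt (1 - w^2 * Real.sin x ^ 2) ≠ 0 := by positivity
    have hcs := Real.sin_sq_add_cos_sq x
    simp only [Pi.mul_apply]
    set D := Real.sqrt (1 - w^2 * Real.sin x ^ 2)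
    have hws : w^2 * Real.sin x ^ 2 = 1 - D^2 := by linarith
    field_simp
    ring_nf
    linear_combination (-Real.cos x^2) * hsq + (2 * D^2) * hcs

theorem J1_cross_integral (r R : ℝ) (hr : 0 < r) (hrR : r ≤ R) :
    2 * R * r * ∫ t in Set.Ioi (0:ℝ), besselJ1 (R * t) * besselJ1 (r * t) / t ^ 2 =
      (4 * R ^ 3 / (3 * Real.pi)) *
        ((1 + r ^ 2 / R ^ 2) * ellE (r / R) - (1 - r ^ 2 / R ^ 2) * ellK (r / R)) := by
  have hR : 0 < R := hr.trans_le hrR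
  rw [fubini_step r R hr hR]
  obtain ⟨w, hw⟩ : ∃ w, w = r / R := ⟨_, rfl⟩
  have hw0 : 0 < w := by rw [hw]; positivity
  have hw1 : w ≤ 1 := by rw [hw]; exact (div_le_one hR).mpr hrR
  have hrw : r = R * w := by rw [hw]; field_simp
  have hD : r ^ 2 / R ^ 2 = w^2 := by rw [hw]; ring
  rw [hD, ← hw]
  have h1 : ∫ φ in (0:ℝ)..Real.pi, ∫ θ in (0:ℝ)..Real.pi,
        Real.sin φ * Real.sin θ * min (R * Real.sin θ) (r * Real.sin φ) =
      ∫ φ in (0:ℝ)..Real.pi, R * (Real.sin φ * (Real.arcsin (w * Real.sin φ) +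
        w * Real.sin φ * Real.sqrt (1 - (w * Real.sin φ)^2))) := by
    refine intervalIntegral.integral_congr fun φ hφ => ?_
    rw [Set.uIcc_of_le Real.pi_pos.le] at hφ
    have hs : 0 ≤ Real.sin φ := Real.sin_nonneg_of_nonneg_of_le_pi hφ.1 hφ.2
    have hs1 := Real.sin_le_one φ
    rw [← inner_int (w * Real.sin φ) (by positivity) (by nlinarith),
      ← intervalIntegral.integral_const_mul, ← intervalIntegral.integral_const_mul]
    refine intervalIntegral.integral_congr fun θ _ => ?_
    rw [hrw, mul_assoc R w, ← mul_min_of_nonneg _ _ hR.le]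
    ring
  have harc := Real.continuous_arcsin
  rw [h1, half_sin (fun s => R * (s * (Real.arcsin (w * s) + w * s * Real.sqrt (1 - (w * s)^2))))
    (by fun_prop), intervalIntegral.integral_const_mul]
  have h2 : ∫ φ in (0:ℝ)..(Real.pi/2), Real.sin φ * (Real.arcsin (w * Real.sin φ) +
        w * Real.sin φ * Real.sqrt (1 - (w * Real.sin φ)^2)) =
      (∫ φ in (0:ℝ)..(Real.pi/2), Real.sin φ * Real.arcsin (w * Real.sin φ)) +
      w * ∫ φ in (0:ℝ)..(Real.pi/2), Real.sin φ ^ 2 * Real.sqrt (1 - w^2 * Real.sin φ ^ 2) := by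
    rw [← intervalIntegral.integral_const_mul, ← intervalIntegral.integral_add
      (Continuous.intervalIntegrable (by fun_prop) _ _) (Continuous.intervalIntegrable (by fun_prop) _ _)]
    refine intervalIntegral.integral_congr fun φ _ => ?_
    simp only [mul_pow]
    ring
  rw [h2, arcsin_part w hw0 hw1]
  have h3 := sinsq_part w hw0 hw1
  have h4 := C_eq w hw0 hw1
  generalize (∫ φ in (0:ℝ)..(Real.pi/2), Real.cos φ ^ 2 / Real.sqrt (1 - w^2 * Real.sin φ ^ 2)) = C at *
  generalize (∫ φ in (0:ℝ)..(Real.pi/2), Real.sin φ ^ 2 * Real.sqrt (1 - w^2 * Real.sin φ ^ 2)) = S at *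
  have hS : S = (2 * ellE w - C) / 3 := by linarith
  have hfin : (1 + w^2) * ellE w - (1 - w^2) * ellK w = w^2 * (C + ellE w) := by linarith
  rw [hfin, hS, hrw]
  have := Real.pi_pos
  field_simp
  ring
end

section
/- For w ∈ [0,1), with G(w) := 1 + w³ + (1−w²)K(w) − (1+w²)E(w), one has the asymptotic G(w) = (3/4)(1−w)² log(2/(1−w)) + O((1−w)²) as w → 1⁻. -/
open Real Set Filter Topology

lemma pos_aux {w : ℝ} (hw : w^2 < 1) (θ : ℝ) : 0 < 1 - w^2 * sin θ ^ 2 := by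
  nlinarith [sin_sq_le_one θ, sq_nonneg (sin θ), sq_nonneg w]

lemma ptwise {m c x : ℝ} (hm : 0 < m) (hc : 0 ≤ c) (hx : 0 ≤ x) (h : c^2 + x^2 = 1) :
    0 ≤ c * (√(m + x^2) - x) - (√(m*c^2 + x^2) - x) ∧
    c * (√(m + x^2) - x) - (√(m*c^2 + x^2) - x) ≤ m := by
  have hc1 : c ≤ 1 := by nlinarith
  have hx1 : x ≤ 1 := by nlinarith
  set D' := √(m + x^2) with hD'
  set D := √(m*c^2 + x^2) with hD
  have h1 : D'^2 = m + x^2 := sq_sqrt (by positivity)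
  have h2 : D^2 = m*c^2 + x^2 := sq_sqrt (by positivity)
  have p1 : 0 ≤ D' := sqrt_nonneg _
  have p2 : 0 ≤ D := sqrt_nonneg _
  have hDD : D ≤ D' := by
    apply sqrt_le_sqrt
    nlinarith
  have hxD : x ≤ D := by
    apply le_sqrt_of_sq_le
    nlinarith [sq_nonneg c]
  have hxD' : x ≤ D' := hxD.trans hDD
  constructor
  · have : D ≤ (1-c)*x + c*D' := by
      apply sqrt_le_iff.2 ⟨by nlinarith, ?_⟩
      have : 0 ≤ c * (1-c) * x * (D' - x) := by
        have := sub_nonneg.2 hc1; have := sub_nonneg.2 hxD'; positivity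
      nlinarith
    linarith
  · have e1 : (D'-x)*(D'+x) = m := by nlinarith
    have e2 : (D-x)*(D+x) = m*c^2 := by nlinarith
    have hp : 0 < D' + x := by nlinarith
    have e3 : c^2*(D'-x) ≤ D - x := by
      have : c^2*(D'-x)*(D'+x) ≤ (D-x)*(D'+x) := by
        nlinarith [mul_nonneg (sub_nonneg.2 hxD) (sub_nonneg.2 hDD)]
      exact le_of_mul_le_mul_right this hp
    have e4 : c*(1-c) ≤ x := by nlinarith
    have := mul_le_mul_of_nonneg_right e4 (sub_nonneg.2 hxD')
    nlinarith [mul_nonneg (sub_nonneg.2 hxD') p1]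

lemma int_aux {m : ℝ} (hm : 0 < m) :
    ∫ θ in (0:ℝ)..(π/2), sin θ * (√(m + cos θ^2) - cos θ)
      = 1/2 * (√(m+1) - 1 + m * log (1 + √(m+1)) - m * log (√m)) := by
  have key : ∀ θ ∈ uIcc (0:ℝ) (π/2), HasDerivAt
      (fun θ => -(1/2 * (cos θ * √(m + cos θ^2) + m * log (cos θ + √(m + cos θ^2))) - cos θ ^2/2))
      (sin θ * (√(m + cos θ^2) - cos θ)) θ := by
    intro θ _
    have hc := hasDerivAt_cos θ
    have hq : 0 < m + cos θ^2 := by positivity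
    have hs := ((hc.pow 2).const_add m).sqrt hq.ne'
    have hpos : 0 < cos θ + √(m + cos θ^2) := by
      have : |cos θ| < √(m + cos θ^2) := by
        apply lt_sqrt_of_sq_lt; rw [sq_abs]; linarith
      linarith [neg_abs_le (cos θ)]
    have hl := (hc.add hs).log hpos.ne'
    have := ((((hc.mul hs).add (hl.const_mul m)).const_mul (1/2)).sub ((hc.pow 2).div_const 2)).neg
    refine this.congr_deriv ?_
    have hS : 0 < √(m + cos θ^2) := sqrt_pos.2 hq
    have hS2 : √(m + cos θ^2)^2 = m + cos θ^2 := sq_sqrt hq.le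
    simp only [Pi.add_apply, Pi.pow_apply] at *
    generalize √(m + cos θ^2) = S at *
    have : m = S^2 - cos θ^2 := by linarith
    subst this
    field_simp
    ring
  rw [intervalIntegral.integral_eq_sub_of_hasDerivAt key]
  · simp [add_comm m 1]; ring
  · apply Continuous.intervalIntegrable; fun_prop

lemma E_bound {w : ℝ} (h0 : 0 ≤ w) (h1 : w < 1) :
    |ellE w - 1 - 1/2 * (1-w) * log (2/(1-w))| ≤ 20 * (1-w) := by
  set m := 1 - w^2 with hm
  have hmp : 0 < m := by nlinarith
  have hI : |ellE w - 1 - ∫ θ in (0:ℝ)..(π/2), sin θ * (√(m + cos θ^2) - cos θ)| ≤ m * |π/2 - 0| := by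
    have h1' : (1:ℝ) = ∫ θ in (0:ℝ)..(π/2), cos θ := by simp
    have : ellE w - 1 - ∫ θ in (0:ℝ)..(π/2), sin θ * (√(m + cos θ^2) - cos θ)
       = ∫ θ in (0:ℝ)..(π/2), (√(1 - w^2 * sin θ^2) - cos θ - sin θ * (√(m + cos θ^2) - cos θ)) := by
      rw [intervalIntegral.integral_sub, intervalIntegral.integral_sub, ← h1', ellE]
      all_goals apply Continuous.intervalIntegrable; fun_prop
    rw [this, ← Real.norm_eq_abs]
    apply intervalIntegral.norm_integral_le_of_norm_le_const
    intro θ hθ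
    rw [uIoc_of_le (by positivity)] at hθ
    have a := ptwise (c := sin θ) (x := cos θ) hmp (sin_nonneg_of_nonneg_of_le_pi hθ.1.le (by linarith [hθ.2, pi_pos]))
      (cos_nonneg_of_neg_pi_div_two_le_of_le (by linarith [hθ.1, pi_pos]) hθ.2) (sin_sq_add_cos_sq θ)
    have e : m * sin θ^2 + cos θ^2 = 1 - w^2 * sin θ^2 := by
      rw [hm]; linarith [sin_sq_add_cos_sq θ]
    rw [e] at a
    rw [Real.norm_eq_abs, abs_le]; constructor <;> linarith [a.1, a.2]
  rw [int_aux hmp] at hI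
  have ht : 0 < 1 - w := by linarith
  have hl1 : log (√m) = 1/2 * (log (1-w) + log (1+w)) := by
    rw [log_sqrt hmp.le, ← log_mul (by linarith) (by linarith), hm]
    rw [show 1 - w^2 = (1-w)*(1+w) by ring]; ring
  rw [hl1] at hI
  rw [log_div two_ne_zero ht.ne']
  have b1 : √(m+1) ≤ 2 := by rw [sqrt_le_iff]; constructor <;> nlinarith
  have b0 : 1 ≤ √(m+1) := by rw [one_le_sqrt]; linarith
  have b2 : √(m+1) - 1 ≤ m := by nlinarith [sq_sqrt (show 0 ≤ m+1 by linarith)]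
  have b3 : log (1+√(m+1)) ≤ 2 := by have := log_le_sub_one_of_pos (show 0 < 1+√(m+1) by linarith); linarith
  have b4 : 0 ≤ log (1+√(m+1)) := log_nonneg (by linarith)
  have b5 : log (1+w) ≤ 1 := by have := log_le_sub_one_of_pos (show 0 < 1+w by linarith); linarith
  have b6 : 0 ≤ log (1+w) := log_nonneg (by linarith)
  have b7 : log (1-w) ≤ 0 := log_nonpos (by linarith) (by linarith)
  have b8 : -log (1-w) * (1-w) ≤ 1 := by
    have := log_le_sub_one_of_pos (inv_pos.2 ht)
    rw [log_inv] at this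
    have h := mul_le_mul_of_nonneg_right this ht.le
    rw [sub_mul, inv_mul_cancel₀ ht.ne'] at h; linarith
  have c1 : log 2 ≤ 1 := by linarith [log_two_lt_d9]
  have c0 : 0 ≤ log 2 := by linarith [log_two_gt_d9]
  have hpi : m * |π/2 - 0| ≤ 2 * m := by
    rw [sub_zero, abs_of_pos (by positivity)]; nlinarith [pi_lt_four]
  have hI := hI.trans hpi
  have hmt : m = 2*(1-w) - (1-w)^2 := by rw [hm]; ring
  have hm2 : m ≤ 2*(1-w) := by nlinarith
  generalize log (1+√(m+1)) = A at *
  generalize log (1-w) = B at *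
  generalize log (1+w) = C at *
  generalize log 2 = T at *
  generalize √(m+1) = S at *
  have d1 := mul_nonneg hmp.le b4
  have d2 := mul_nonneg hmp.le (sub_nonneg.2 b3)
  have d3 := mul_nonneg hmp.le b6
  have d4 := mul_nonneg hmp.le (sub_nonneg.2 b5)
  have d5 := mul_nonneg ht.le c0
  have d6 := mul_nonneg ht.le (sub_nonneg.2 c1)
  have d7 := mul_nonneg ht.le (sub_nonneg.2 b8)
  have d8 : 0 ≤ (1-w) * (-B * (1-w)) := mul_nonneg ht.le (mul_nonneg (by linarith) ht.le)
  have d9 : m * B = 2*((1-w)*B) - (1-w)^2*B := by rw [hmt]; ring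
  rw [abs_le] at hI ⊢
  constructor <;> nlinarith [hI.1, hI.2]

noncomputable def hI (w θ : ℝ) : ℝ :=
  (1 - w^2) * (1 / √(1 - w^2 * sin θ^2)) - (1 + w^2) * √(1 - w^2 * sin θ^2)

noncomputable def hI' (w θ : ℝ) : ℝ :=
  -3 * w * √(1 - w^2 * sin θ^2) - w * ((1 - 2 * sin θ^2 + w^2 * sin θ^4) / √(1 - w^2 * sin θ^2)^3)

lemma cont_inv {w : ℝ} (hw : w^2 < 1) : Continuous fun θ => 1 / √(1 - w^2 * sin θ^2) := by
  apply Continuous.div continuous_const (by fun_prop)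
  intro θ; exact (sqrt_pos.2 (pos_aux hw θ)).ne'

lemma cont_hI {w : ℝ} (hw : w^2 < 1) : Continuous (hI w) := by
  have := cont_inv hw
  unfold hI; fun_prop

lemma cont_q {w : ℝ} (hw : w^2 < 1) : Continuous fun θ =>
    (1 - 2 * sin θ^2 + w^2 * sin θ^4) / √(1 - w^2 * sin θ^2)^3 := by
  apply Continuous.div (by fun_prop) (by fun_prop)
  intro θ; exact (pow_pos (sqrt_pos.2 (pos_aux hw θ)) 3).ne'

lemma cont_hI' {w : ℝ} (hw : w^2 < 1) : Continuous (hI' w) := by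
  have := cont_q hw
  unfold hI'; fun_prop

lemma int_q {w : ℝ} (hw : w^2 < 1) : ∫ θ in (0:ℝ)..(π/2),
    (1 - 2 * sin θ^2 + w^2 * sin θ^4) / √(1 - w^2 * sin θ^2)^3 = 0 := by
  have key : ∀ θ ∈ uIcc (0:ℝ) (π/2), HasDerivAt
      (fun θ => sin θ * cos θ / √(1 - w^2 * sin θ^2))
      ((1 - 2 * sin θ^2 + w^2 * sin θ^4) / √(1 - w^2 * sin θ^2)^3) θ := by
    intro θ _
    have hq := pos_aux hw θ
    have hs := ((((hasDerivAt_sin θ).pow 2).const_mul (w^2)).const_sub 1).sqrt hq.ne'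
    have hS : 0 < √(1 - w^2 * sin θ^2) := sqrt_pos.2 hq
    refine (((hasDerivAt_sin θ).mul (hasDerivAt_cos θ)).div hs hS.ne').congr_deriv ?_
    have hS2 : √(1 - w^2 * sin θ^2)^2 = 1 - w^2 * sin θ^2 := sq_sqrt hq.le
    simp only [Pi.mul_apply, Pi.pow_apply] at *
    generalize √(1 - w^2 * sin θ^2) = S at *
    have hc : cos θ^2 = 1 - sin θ^2 := by linarith [sin_sq_add_cos_sq θ]
    field_simp
    push_cast
    ring_nf
    rw [show S^2 = 1 - w^2 * sin θ^2 from hS2, hc]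
    ring
  rw [intervalIntegral.integral_eq_sub_of_hasDerivAt key]
  · simp
  · exact (cont_q hw).intervalIntegrable _ _

lemma hasDeriv_hI {w : ℝ} (hw : w^2 < 1) (θ : ℝ) :
    HasDerivAt (fun w => hI w θ) (hI' w θ) w := by
  have hq := pos_aux hw θ
  have hS : 0 < √(1 - w^2 * sin θ^2) := sqrt_pos.2 hq
  have hS2 : √(1 - w^2 * sin θ^2)^2 = 1 - w^2 * sin θ^2 := sq_sqrt hq.le
  have hp := (hasDerivAt_id w).pow 2
  have hs := ((hp.mul_const (sin θ^2)).const_sub 1).sqrt hq.ne'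
  have := ((hp.const_sub 1).mul ((hasDerivAt_const w (1:ℝ)).div hs hS.ne')).sub ((hp.const_add 1).mul hs)
  refine this.congr_deriv ?_
  unfold hI'
  simp only [Pi.pow_apply, Pi.div_apply, id] at *
  generalize √(1 - w^2 * sin θ^2) = S at *
  have h4 : S^4 = (1 - w^2 * sin θ^2)^2 := by rw [← hS2]; ring
  field_simp
  push_cast
  ring_nf
  rw [show S^4 = _ from h4, show S^2 = _ from hS2]
  ring

lemma H_deriv {w : ℝ} (hw : w^2 < 1) :
    HasDerivAt (fun w => ∫ θ in (0:ℝ)..(π/2), hI w θ) (-3 * w * ellE w) w := by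
  obtain ⟨r, hr1, hr2⟩ := exists_between hw
  have hopen : IsOpen {v : ℝ | v^2 < r} := isOpen_lt (by fun_prop) continuous_const
  have hmem : {v : ℝ | v^2 < r} ∈ 𝓝 w := hopen.mem_nhds hr1
  have h1r : 0 < 1 - r := by linarith
  have := intervalIntegral.hasDerivAt_integral_of_dominated_loc_of_deriv_le
    (μ := MeasureTheory.volume) (a := 0) (b := π/2) (F := hI) (F' := hI') (x₀ := w)
    (s := {v : ℝ | v^2 < r}) (bound := fun _ => 3 + 2 / √(1-r)^3) hmem
    (by filter_upwards [hmem] with v hv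
        exact (cont_hI (lt_trans hv hr2)).aestronglyMeasurable)
    ((cont_hI hw).intervalIntegrable _ _)
    (cont_hI' hw).aestronglyMeasurable
    (by
      refine Eventually.of_forall fun θ _ v hv => ?_
      have hv : v^2 < r := hv
      have hv1 : |v| ≤ 1 := by rw [← sq_le_one_iff_abs_le_one]; linarith
      have s0 := sq_nonneg (sin θ)
      have s1 := sin_sq_le_one θ
      have hS0 : 0 < √(1-r) := sqrt_pos.2 h1r
      have hS : √(1-r) ≤ √(1 - v^2 * sin θ^2) := sqrt_le_sqrt (by nlinarith [sq_nonneg v])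
      have hS1 : √(1 - v^2 * sin θ^2) ≤ 1 := by
        rw [sqrt_le_iff]; constructor <;> nlinarith [mul_nonneg (sq_nonneg v) s0]
      have hN : |1 - 2 * sin θ^2 + v^2 * sin θ^4| ≤ 2 := by
        rw [show sin θ^4 = (sin θ^2)^2 by ring, abs_le]
        have : (sin θ^2)^2 ≤ 1 := by nlinarith
        constructor <;> nlinarith [mul_nonneg (sq_nonneg v) (sq_nonneg (sin θ^2))]
      unfold hI'
      refine (norm_sub_le _ _).trans (add_le_add ?_ ?_)
      · rw [norm_mul, norm_mul, Real.norm_eq_abs, Real.norm_eq_abs, Real.norm_eq_abs,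
          abs_of_nonneg (sqrt_nonneg _)]
        norm_num
        nlinarith [abs_nonneg v, sqrt_nonneg (1 - v^2 * sin θ^2)]
      · rw [norm_mul, Real.norm_eq_abs, Real.norm_eq_abs, abs_div,
          abs_of_nonneg (pow_nonneg (sqrt_nonneg (1 - v^2 * sin θ^2)) 3)]
        calc _ ≤ 1 * (2 / √(1-r)^3) := by gcongr
          _ = _ := one_mul _)
    (by simp)
    (Eventually.of_forall fun θ _ v hv => hasDeriv_hI (lt_trans hv hr2) θ)
  refine this.2.congr_deriv ?_
  unfold hI' ellE
  rw [intervalIntegral.integral_sub, intervalIntegral.integral_const_mul,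
    intervalIntegral.integral_const_mul, int_q hw]
  · ring
  · apply Continuous.intervalIntegrable; fun_prop
  · have := cont_q hw
    apply Continuous.intervalIntegrable; fun_prop

lemma G_eq {w : ℝ} (hw : w^2 < 1) : Gfun w = 1 + w^3 + ∫ θ in (0:ℝ)..(π/2), hI w θ := by
  unfold Gfun ellK ellE hI
  rw [intervalIntegral.integral_sub, intervalIntegral.integral_const_mul,
    intervalIntegral.integral_const_mul]
  · ring
  · exact ((cont_inv hw).const_mul _).intervalIntegrable _ _
  · apply Continuous.intervalIntegrable; fun_prop

lemma G_deriv {w : ℝ} (hw : w^2 < 1) : HasDerivAt Gfun (3 * w^2 - 3 * w * ellE w) w := by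
  have hopen : IsOpen {v : ℝ | v^2 < 1} := isOpen_lt (by fun_prop) continuous_const
  have h := ((hasDerivAt_pow 3 w).const_add 1).add (H_deriv hw)
  refine (h.congr_of_eventuallyEq ?_).congr_deriv ?_
  · filter_upwards [hopen.mem_nhds hw] with v hv
    exact G_eq hv
  · norm_num; ring

lemma F_deriv {w : ℝ} (h0 : 0 ≤ w) (h1 : w < 1) :
    HasDerivAt (fun w => Gfun w - 3 / 4 * (1 - w) ^ 2 * log (2 / (1 - w)))
      (3 * w^2 - 3 * w * ellE w + 3/2 * (1-w) * log (2/(1-w)) - 3/4 * (1-w)) w := by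
  have ht : 1 - w ≠ 0 := by linarith
  have a := (hasDerivAt_id w).const_sub 1
  have l := ((hasDerivAt_const w (2:ℝ)).div a ht).log (div_ne_zero two_ne_zero ht)
  refine ((G_deriv (by nlinarith)).sub (((a.pow 2).const_mul (3/4)).mul l)).congr_deriv ?_
  simp only [Pi.pow_apply, Pi.div_apply, id] at *
  field_simp
  ring

lemma tl_bound {t : ℝ} (ht : 0 < t) (h1 : t ≤ 1) : 0 ≤ t * log (2/t) ∧ t * log (2/t) ≤ 2 := by
  have h2 : 1 ≤ 2 / t := by rw [le_div_iff₀ ht]; linarith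
  refine ⟨mul_nonneg ht.le (log_nonneg h2), ?_⟩
  have := log_le_sub_one_of_pos (show 0 < 2/t by linarith)
  have h := mul_le_mul_of_nonneg_left this ht.le
  have e : t * (2/t) = 2 := by field_simp
  nlinarith

lemma F_deriv_bound {w : ℝ} (h0 : 0 ≤ w) (h1 : w < 1) :
    |3 * w^2 - 3 * w * ellE w + 3/2 * (1-w) * log (2/(1-w)) - 3/4 * (1-w)| ≤ 200 * (1-w) := by
  have hE := E_bound h0 h1
  have ⟨l0, l1⟩ := tl_bound (t := 1-w) (by linarith) (by linarith)
  set l := log (2/(1-w))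
  set e := ellE w - 1 - 1/2*(1-w)*l with he
  have hEe : ellE w = e + 1 + 1/2*(1-w)*l := by rw [he]; ring
  rw [hEe]
  have ht : 0 < 1 - w := by linarith
  rw [abs_le] at hE ⊢
  have q1 := mul_nonneg ht.le l0
  have q2 := mul_nonneg ht.le (sub_nonneg.2 l1)
  have q3 := mul_nonneg h0 (sub_nonneg.2 hE.1)
  have q4 := mul_nonneg h0 (sub_nonneg.2 hE.2)
  have q5 := mul_nonneg h0 ht.le
  constructor <;> nlinarith

lemma tl_tendsto : Tendsto (fun w : ℝ => (1-w) * log (2/(1-w))) (𝓝[<] 1) (𝓝 0) := by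
  have h : Continuous fun w : ℝ => (1-w) * log 2 + negMulLog (1-w) := by fun_prop
  have h2 := (h.tendsto 1).mono_left (nhdsWithin_le_nhds (s := Iio 1))
  simp only [sub_self, zero_mul, negMulLog_zero, add_zero] at h2
  refine h2.congr' ?_
  filter_upwards [self_mem_nhdsWithin] with w hw
  have : 0 < 1 - w := by have : w < 1 := hw; linarith
  rw [log_div two_ne_zero this.ne', negMulLog]; ring

lemma near : ∀ᶠ w : ℝ in 𝓝[<] 1, 0 ≤ w ∧ w < 1 := by
  filter_upwards [Ioo_mem_nhdsLT (show (0:ℝ) < 1 by norm_num)] with w hw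
  exact ⟨hw.1.le, hw.2⟩

lemma E_tendsto : Tendsto ellE (𝓝[<] 1) (𝓝 1) := by
  have hb : Tendsto (fun w : ℝ => 20 * (1-w)) (𝓝[<] 1) (𝓝 0) := by
    have h : Continuous fun w : ℝ => 20 * (1-w) := by fun_prop
    simpa using (h.tendsto 1).mono_left (nhdsWithin_le_nhds (s := Iio 1))
  have h := squeeze_zero_norm' (f := fun w => ellE w - 1 - 1/2 * (1-w) * log (2/(1-w))) (by
    filter_upwards [near] with w hw
    exact E_bound hw.1 hw.2) hb
  have := (h.add (tl_tendsto.const_mul (1/2))).add_const 1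
  simp only [mul_zero, zero_add] at this
  refine this.congr fun w => ?_
  ring

lemma K_tendsto : Tendsto (fun w => (1-w^2) * ellK w) (𝓝[<] 1) (𝓝 0) := by
  have hb : Tendsto (fun w : ℝ => √(1-w^2) * |π/2 - 0|) (𝓝[<] 1) (𝓝 0) := by
    have h : Continuous fun w : ℝ => √(1-w^2) * |π/2 - 0| := by fun_prop
    simpa using (h.tendsto 1).mono_left (nhdsWithin_le_nhds (s := Iio 1))
  refine squeeze_zero_norm' ?_ hb
  filter_upwards [near] with w ⟨h0, h1⟩
  unfold ellK
  rw [← intervalIntegral.integral_const_mul]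
  apply intervalIntegral.norm_integral_le_of_norm_le_const
  intro θ _
  have hm : 0 < 1 - w^2 := by nlinarith
  have hS : √(1-w^2) ≤ √(1 - w^2 * sin θ^2) :=
    sqrt_le_sqrt (by nlinarith [sq_nonneg w, sin_sq_le_one θ])
  have hp := sqrt_pos.2 hm
  rw [Real.norm_of_nonneg (by positivity), mul_one_div, div_le_iff₀ (hp.trans_le hS)]
  nlinarith [sq_sqrt hm.le]

lemma F_tendsto : Tendsto (fun w => Gfun w - 3 / 4 * (1 - w) ^ 2 * log (2 / (1 - w)))
    (𝓝[<] 1) (𝓝 0) := by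
  have p (f : ℝ → ℝ) (hf : Continuous f) : Tendsto f (𝓝[<] 1) (𝓝 (f 1)) :=
    (hf.tendsto 1).mono_left nhdsWithin_le_nhds
  have h := (((p (fun w => 1 + w^3) (by fun_prop)).add K_tendsto).sub
    ((p (fun w => 1 + w^2) (by fun_prop)).mul E_tendsto)).sub
    ((p (fun w => 3/4 * (1-w)) (by fun_prop)).mul tl_tendsto)
  norm_num at h
  refine h.congr fun w => ?_
  unfold Gfun
  ring

lemma sq_tendsto (C : ℝ) : Tendsto (fun w : ℝ => C * (1 - w) ^ 2) (𝓝[<] 1) (𝓝 0) := by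
  have h : Continuous fun w : ℝ => C * (1-w)^2 := by fun_prop
  simpa using (h.tendsto 1).mono_left (nhdsWithin_le_nhds (s := Iio 1))

/-- a nonincreasing function tending to `0` at `1` is nonnegative -/
lemma nonneg_of_deriv {f f' : ℝ → ℝ} (hd : ∀ w, 0 ≤ w → w < 1 → HasDerivAt f (f' w) w)
    (hn : ∀ w, 0 ≤ w → w < 1 → f' w ≤ 0) (ht : Tendsto f (𝓝[<] 1) (𝓝 0))
    {w : ℝ} (h0 : 0 ≤ w) (h1 : w < 1) : 0 ≤ f w := by
  have hanti : AntitoneOn f (Ico 0 1) := by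
    apply antitoneOn_of_deriv_nonpos (convex_Ico 0 1)
    · exact fun x hx => (hd x hx.1 hx.2).continuousAt.continuousWithinAt
    · intro x hx
      rw [interior_Ico] at hx
      exact (hd x hx.1.le hx.2).differentiableAt.differentiableWithinAt
    · intro x hx
      rw [interior_Ico] at hx
      rw [(hd x hx.1.le hx.2).deriv]
      exact hn x hx.1.le hx.2
  refine le_of_tendsto ht ?_
  filter_upwards [Ioo_mem_nhdsLT h1] with v hv
  exact hanti ⟨h0, h1⟩ ⟨h0.trans hv.1.le, hv.2⟩ hv.1.le

theorem G_asymp :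
    ∃ C > 0, ∀ w : ℝ, 0 ≤ w → w < 1 →
      |Gfun w - 3 / 4 * (1 - w) ^ 2 * Real.log (2 / (1 - w))| ≤ C * (1 - w) ^ 2 := by
  refine ⟨100, by norm_num, fun w h0 h1 => ?_⟩
  have hsq (v : ℝ) : HasDerivAt (fun w : ℝ => 100 * (1-w)^2) (-200 * (1-v)) v := by
    refine ((((hasDerivAt_id v).const_sub 1).pow 2).const_mul 100).congr_deriv ?_
    simp; ring
  have A := nonneg_of_deriv (fun v a b => (hsq v).sub (F_deriv a b))
    (fun v a b => by have := abs_le.1 (F_deriv_bound a b); linarith [this.1])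
    (by have := (sq_tendsto 100).sub F_tendsto; rw [sub_zero] at this; exact this) h0 h1
  have B := nonneg_of_deriv (fun v a b => (hsq v).add (F_deriv a b))
    (fun v a b => by have := abs_le.1 (F_deriv_bound a b); linarith [this.2])
    (by have := (sq_tendsto 100).add F_tendsto; rw [add_zero] at this; exact this) h0 h1
  simp only [Pi.sub_apply, Pi.add_apply] at A B
  rw [abs_le]; constructor <;> linarith
end

section
/- For the Bessel function J₀ and all real x with |x| ≥ 1, |J₀(x) − √(2/(π|x|)) cos(|x| − π/4)| ≤ C/|x|^{3/2} for an absolute constant C; and for |x| ≤ 1, |J₀(x) − 1| ≤ x². -/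
noncomputable def besselJ0 (x : ℝ) : ℝ :=
  (1 / Real.pi) * ∫ θ in (0:ℝ)..Real.pi, Real.cos (x * Real.sin θ)
open MeasureTheory Filter Topology Set

noncomputable def BF (x : ℝ) (z : ℂ) : ℂ :=
  Complex.exp (Complex.I * x * z) * (1 - z ^ 2) ^ (((-(1 / 2) : ℝ)) : ℂ)

lemma norm_BF (x : ℝ) (z : ℂ) :
    ‖BF x z‖ = Real.exp (-(x * z.im)) * ‖1 - z ^ 2‖ ^ (-(1 / 2) : ℝ) := by
  unfold BF
  rw [norm_mul, Complex.norm_cpow_real, Complex.norm_exp]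
  congr 2
  simp

lemma slit_aux (a v : ℝ) (h : 0 < 1 - a ^ 2 + v ^ 2) :
    (1 - ((a : ℂ) + v * Complex.I) ^ 2) ∈ Complex.slitPlane := by
  left
  have : (1 - ((a : ℂ) + v * Complex.I) ^ 2).re = 1 - a ^ 2 + v ^ 2 := by
    simp [pow_two]; ring
  rw [this]; exact h

lemma BF_diff (x : ℝ) (z : ℂ) (h : (1 - z ^ 2) ∈ Complex.slitPlane) :
    DifferentiableAt ℂ (BF x) z := by
  unfold BF
  apply DifferentiableAt.mul
  · fun_prop
  · exact DifferentiableAt.cpow_const (by fun_prop) h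

lemma L1 (x α : ℝ) (h0 : 0 ≤ α) (h1 : α < Real.pi / 2) :
    (∫ t in (0:ℝ)..Real.sin α, BF x t).re = ∫ θ in (0:ℝ)..α, Real.cos (x * Real.sin θ) := by
  have hcos : ∀ θ ∈ Icc 0 α, 0 < Real.cos θ := fun θ hθ =>
    Real.cos_pos_of_mem_Ioo ⟨by linarith [hθ.1, Real.pi_pos], by linarith [hθ.2]⟩
  have e : (∫ t in (0:ℝ)..Real.sin α, BF x t)
      = ∫ θ in (0:ℝ)..α, Complex.exp (((x * Real.sin θ : ℝ) : ℂ) * Complex.I) := by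
    have := intervalIntegral.integral_deriv_smul_comp'' (a := 0) (b := α) (f := Real.sin)
      (f' := Real.cos) (g := fun t : ℝ => BF x t) Real.continuous_sin.continuousOn
      (fun θ _ => (Real.hasDerivAt_sin θ).hasDerivWithinAt) Real.continuous_cos.continuousOn ?_
    · rw [Real.sin_zero] at this
      rw [← this]
      apply intervalIntegral.integral_congr
      intro θ hθ
      rw [uIcc_of_le h0] at hθ
      have hc := hcos θ hθ
      have e1 : (1 - ((Real.sin θ : ℝ) : ℂ) ^ 2) = ((Real.cos θ ^ 2 : ℝ) : ℂ) := by
        rw [Real.cos_sq']; push_cast; ring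
      simp only [Function.comp, BF]
      rw [e1, ← Complex.ofReal_cpow (by positivity), ← Real.rpow_natCast, ← Real.rpow_mul hc.le]
      have : ((2:ℕ):ℝ) * (-(1/2)) = -1 := by norm_num
      rw [this, Real.rpow_neg_one, Complex.real_smul]
      have hc' : ((Real.cos θ : ℝ) : ℂ) ≠ 0 := by exact_mod_cast hc.ne'
      rw [Complex.ofReal_inv, mul_comm, mul_assoc, inv_mul_cancel₀ hc', mul_one]
      congr 1
      push_cast; ring
    · rintro _ ⟨θ, hθ, rfl⟩
      rw [uIcc_of_le h0] at hθ
      have hc := hcos θ hθ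
      have hd := BF_diff x (Real.sin θ) (by
        have := slit_aux (Real.sin θ) 0 (by nlinarith [Real.sin_sq_add_cos_sq θ])
        simpa using this)
      have : ContinuousAt (fun t : ℝ => BF x t) (Real.sin θ) :=
        ContinuousAt.comp (f := fun t : ℝ => (t : ℂ)) (g := BF x) hd.continuousAt
          Complex.continuous_ofReal.continuousAt
      exact this.continuousWithinAt
  rw [e]
  have := Complex.reCLM.intervalIntegral_comp_comm (μ := volume) (a := 0) (b := α)
    (f := fun θ => Complex.exp (((x * Real.sin θ : ℝ) : ℂ) * Complex.I)) (by
      apply Continuous.intervalIntegrable; fun_prop)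
  simp only [Complex.reCLM_apply] at this
  rw [← this]
  apply intervalIntegral.integral_congr
  intro θ _
  simp only [Complex.exp_ofReal_mul_I_re]

noncomputable def BR (x a : ℝ) : ℂ := ∫ y in (0:ℝ)..1, BF x (a + y * Complex.I)

lemma L2 (x a : ℝ) (h0 : 0 ≤ a) (h1 : a < 1) :
    |(∫ t in (0:ℝ)..a, BF x t).re + (Complex.I * BR x a).re| ≤ Real.exp (-x) := by
  have H := Complex.integral_boundary_rect_eq_zero_of_differentiableOn (BF x) 0 (a + Complex.I) (by
    intro z hz
    rw [Complex.mem_reProdIm] at hz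
    simp only [Complex.zero_re, Complex.zero_im, Complex.add_re, Complex.add_im, Complex.ofReal_re,
      Complex.ofReal_im, Complex.I_re, Complex.I_im, add_zero, zero_add, uIcc_of_le h0,
      uIcc_of_le zero_le_one] at hz
    apply DifferentiableAt.differentiableWithinAt
    apply BF_diff
    rw [← Complex.re_add_im z]
    apply slit_aux
    nlinarith [hz.1.1, hz.1.2, sq_nonneg z.im])
  simp only [Complex.zero_re, Complex.zero_im, Complex.add_re, Complex.add_im, Complex.ofReal_re,
      Complex.ofReal_im, Complex.I_re, Complex.I_im, add_zero, zero_add, Complex.ofReal_zero,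
      zero_mul, Complex.ofReal_one, one_mul, smul_eq_mul] at H
  have hl : (Complex.I * ∫ y in (0:ℝ)..1, BF x (y * Complex.I)).re = 0 := by
    have : (∫ y in (0:ℝ)..1, BF x (y * Complex.I))
        = ((∫ y in (0:ℝ)..1, Real.exp (-(x * y)) * (1 + y ^ 2) ^ (-(1 / 2) : ℝ) : ℝ) : ℂ) := by
      rw [← intervalIntegral.integral_ofReal]
      apply intervalIntegral.integral_congr
      intro y _
      simp only [BF]
      have e1 : (1 - ((y:ℂ) * Complex.I) ^ 2) = ((1 + y ^ 2 : ℝ) : ℂ) := by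
        rw [mul_pow, Complex.I_sq]; push_cast; ring
      rw [e1, ← Complex.ofReal_cpow (by positivity), Complex.ofReal_mul, Complex.ofReal_exp]
      congr 2
      push_cast
      linear_combination (x * y : ℂ) * Complex.I_sq
    rw [this]; simp
  have ht : ‖∫ t in (0:ℝ)..a, BF x (t + Complex.I)‖ ≤ Real.exp (-x) := by
    have := intervalIntegral.norm_integral_le_of_norm_le_const (a := 0) (b := a)
      (f := fun t : ℝ => BF x (t + Complex.I)) (C := Real.exp (-x)) (by
        intro t ht
        rw [uIoc_of_le h0] at ht
        rw [norm_BF]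
        have e : (1:ℝ) ≤ ‖1 - ((t:ℂ) + Complex.I) ^ 2‖ := by
          refine le_trans ?_ (Complex.re_le_norm _)
          simp [pow_two]
          nlinarith [ht.1, ht.2]
        have := Real.rpow_le_one_of_one_le_of_nonpos e (show (-(1/2):ℝ) ≤ 0 by norm_num)
        have hp := Real.exp_pos (-x)
        simp only [Complex.add_im, Complex.ofReal_im, Complex.I_im, zero_add, mul_one]
        nlinarith)
    rw [sub_zero, abs_of_nonneg h0] at this
    nlinarith [Real.exp_pos (-x)]
  have H2 := congrArg Complex.re H
  simp only [Complex.sub_re, Complex.add_re, Complex.zero_re] at H2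
  rw [hl] at H2
  refine le_trans ?_ ht
  refine le_trans (le_of_eq ?_) (Complex.abs_re_le_norm _)
  congr 1
  unfold BR
  linarith

lemma L3a (x : ℝ) (hx : 0 ≤ x) : Tendsto (BR x) (𝓝[<] 1) (𝓝 (BR x 1)) := by
  unfold BR
  apply intervalIntegral.tendsto_integral_filter_of_dominated_convergence
    (fun v : ℝ => v ^ (-(1 / 2) : ℝ))
  · filter_upwards [Ioo_mem_nhdsLT (show (1/2:ℝ) < 1 by norm_num)] with a ha
    apply Measurable.aestronglyMeasurable
    unfold BF
    fun_prop
  · filter_upwards [Ioo_mem_nhdsLT (show (1/2:ℝ) < 1 by norm_num)] with a ha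
    refine Eventually.of_forall fun v hv => ?_
    rw [uIoc_of_le zero_le_one] at hv
    rw [norm_BF]
    have e : v ≤ ‖1 - ((a:ℂ) + v * Complex.I) ^ 2‖ := by
      refine le_trans ?_ (Complex.abs_im_le_norm _)
      refine le_trans ?_ (neg_le_abs _)
      simp [pow_two]
      nlinarith [hv.1, hv.2, ha.1, ha.2]
    have h1 := Real.rpow_le_rpow_of_nonpos hv.1 e (show (-(1/2):ℝ) ≤ 0 by norm_num)
    have h2 : Real.exp (-(x * ((a:ℂ) + v * Complex.I).im)) ≤ 1 := by
      rw [Real.exp_le_one_iff]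
      simp
      exact mul_nonneg hx hv.1.le
    calc _ ≤ 1 * v ^ (-(1/2):ℝ) := by gcongr
      _ = _ := one_mul _
  · exact intervalIntegral.intervalIntegrable_rpow' (by norm_num)
  · refine Eventually.of_forall fun v hv => ?_
    rw [uIoc_of_le zero_le_one] at hv
    apply Tendsto.mono_left _ nhdsWithin_le_nhds
    have hd := BF_diff x ((1:ℝ) + v * Complex.I) (slit_aux 1 v (by have := pow_pos hv.1 2; linarith))
    exact ContinuousAt.comp (f := fun a : ℝ => (a : ℂ) + v * Complex.I) (g := BF x)
      hd.continuousAt (by fun_prop)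

lemma L3 (x : ℝ) (hx : 0 ≤ x) :
    |(∫ θ in (0:ℝ)..(Real.pi / 2), Real.cos (x * Real.sin θ)) + (Complex.I * BR x 1).re|
      ≤ Real.exp (-x) := by
  have hpi := Real.pi_pos
  have hsin : Tendsto Real.sin (𝓝[<] (Real.pi / 2)) (𝓝[<] 1) := by
    apply tendsto_nhdsWithin_of_tendsto_nhds_of_eventually_within
    · have := Real.continuous_sin.tendsto (Real.pi / 2)
      rw [Real.sin_pi_div_two] at this
      exact this.mono_left nhdsWithin_le_nhds
    · filter_upwards [Ioo_mem_nhdsLT (show (0:ℝ) < Real.pi / 2 by positivity)] with α hα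
      have := Real.sin_lt_sin_of_lt_of_le_pi_div_two (by linarith [hα.1]) le_rfl hα.2
      rwa [Real.sin_pi_div_two] at this
  have hP : Tendsto (fun α => ∫ θ in (0:ℝ)..α, Real.cos (x * Real.sin θ)) (𝓝[<] (Real.pi / 2))
      (𝓝 (∫ θ in (0:ℝ)..(Real.pi / 2), Real.cos (x * Real.sin θ))) := by
    have := intervalIntegral.continuous_primitive (μ := volume)
      (f := fun θ => Real.cos (x * Real.sin θ))
      (fun a b => by apply Continuous.intervalIntegrable; fun_prop) 0
    exact (this.tendsto _).mono_left nhdsWithin_le_nhds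
  have hR := (L3a x hx).comp hsin
  have hR2 := (Complex.continuous_re.tendsto _).comp (hR.const_mul Complex.I)
  refine le_of_tendsto (hP.add hR2).abs ?_
  filter_upwards [Ioo_mem_nhdsLT (show (0:ℝ) < Real.pi / 2 by positivity)] with α hα
  have hs1 : Real.sin α < 1 := by
    have := Real.sin_lt_sin_of_lt_of_le_pi_div_two (by linarith [hα.1]) le_rfl hα.2
    rwa [Real.sin_pi_div_two] at this
  have hs0 : 0 ≤ Real.sin α := Real.sin_nonneg_of_nonneg_of_le_pi hα.1.le (by linarith [hα.2])
  have := L2 x _ hs0 hs1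
  rwa [L1 x α hα.1.le hα.2] at this

noncomputable def BG (v : ℝ) : ℂ := ((v : ℂ) - 2 * Complex.I) ^ (((-(1 / 2) : ℝ)) : ℂ)

lemma BG_norm_aux (v : ℝ) : (2:ℝ) ≤ ‖(v : ℂ) - 2 * Complex.I‖ := by
  refine le_trans ?_ (Complex.abs_im_le_norm _)
  simp

lemma BG_slit (v : ℝ) : ((v : ℂ) - 2 * Complex.I) ∈ Complex.slitPlane := by
  right; simp

lemma BG_norm (v : ℝ) : ‖BG v‖ ≤ 1 := by
  unfold BG
  rw [Complex.norm_cpow_real]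
  exact Real.rpow_le_one_of_one_le_of_nonpos (by linarith [BG_norm_aux v]) (by norm_num)

lemma BG_lip (v : ℝ) (hv : 0 ≤ v) : ‖BG v - BG 0‖ ≤ v := by
  have := norm_image_sub_le_of_norm_deriv_le_segment' (f := BG) (a := 0) (b := v) (C := 1)
    (f' := fun v => (((-(1 / 2) : ℝ)) : ℂ) *
      ((v : ℂ) - 2 * Complex.I) ^ ((((-(1 / 2) : ℝ)) : ℂ) - 1) * 1) ?_ ?_ v ⟨hv, le_rfl⟩
  · simpa using this
  · intro w _
    apply HasDerivAt.hasDerivWithinAt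
    unfold BG
    have h1 : HasDerivAt (fun w : ℝ => (w : ℂ) - 2 * Complex.I) 1 w :=
      (Complex.ofRealCLM.hasDerivAt (x := w)).sub_const _
    have h2 : HasDerivAt (fun z : ℂ => z ^ (((-(1 / 2) : ℝ)) : ℂ)) _ ((w : ℂ) - 2 * Complex.I) :=
      (hasDerivAt_id _).cpow_const (BG_slit w)
    have := HasDerivAt.comp_of_eq w h2 h1 rfl
    simpa [Function.comp_def] using this
  · intro w _
    have e : ((((-(1 / 2) : ℝ)) : ℂ) - 1) = (((-(3 / 2) : ℝ)) : ℂ) := by push_cast; norm_num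
    rw [e, mul_one, norm_mul, Complex.norm_cpow_real, Complex.norm_real]
    have := Real.rpow_le_one_of_one_le_of_nonpos (x := ‖(w : ℂ) - 2 * Complex.I‖)
      (by linarith [BG_norm_aux w]) (show (-(3/2):ℝ) ≤ 0 by norm_num)
    have h3 : ‖(-(1/2):ℝ)‖ = 1/2 := by rw [norm_neg, Real.norm_eq_abs, abs_of_pos (by norm_num)]
    rw [h3]; linarith

lemma BG_zero : BG 0 = Complex.exp ((Real.pi / 4 : ℝ) * Complex.I) * ((1 / √2 : ℝ) : ℂ) := by
  unfold BG
  have h : ((0:ℝ):ℂ) - 2 * Complex.I = (2:ℝ) * (-Complex.I) := by push_cast; ring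
  rw [h, Complex.cpow_def_of_ne_zero (by simp), Complex.log_ofReal_mul (by norm_num) (by simp),
    Complex.log_neg_I, add_mul, Complex.exp_add, mul_comm]
  congr 1
  · congr 1; push_cast; ring
  · rw [← Complex.ofReal_mul, ← Complex.ofReal_exp, ← Real.rpow_def_of_pos (by norm_num),
      Real.rpow_neg (by norm_num), ← Real.sqrt_eq_rpow, one_div]

lemma BF_right (x v : ℝ) (hv : 0 < v) : BF x ((1:ℝ) + v * Complex.I) =
    Complex.exp (x * Complex.I) *
      (((v ^ (-(1 / 2) : ℝ) * Real.exp (-(x * v)) : ℝ) : ℂ) * BG v) := by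
  unfold BF BG
  have h : (1 - (((1:ℝ):ℂ) + v * Complex.I) ^ 2) = (v : ℂ) * ((v : ℂ) - 2 * Complex.I) := by
    push_cast
    linear_combination -(v:ℂ)^2 * Complex.I_sq
  have hne := Complex.slitPlane_ne_zero (BG_slit v)
  have hv' : (v : ℂ) ≠ 0 := by exact_mod_cast hv.ne'
  rw [h, Complex.cpow_def_of_ne_zero (mul_ne_zero hv' hne), Complex.log_ofReal_mul hv hne,
    add_mul, Complex.exp_add, Complex.cpow_def_of_ne_zero hne, Real.rpow_def_of_pos hv]
  have h2 : Complex.exp (Complex.I * x * (((1:ℝ):ℂ) + v * Complex.I))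
      = Complex.exp (x * Complex.I) * Complex.exp (-(x * v)) := by
    rw [← Complex.exp_add]; congr 1; push_cast
    linear_combination (x * v : ℂ) * Complex.I_sq
  rw [h2]
  push_cast
  ring

lemma int_aux_s19 (x s : ℝ) (hx : 0 < x) (hs : -1 < s) :
    IntegrableOn (fun v : ℝ => v ^ s * Real.exp (-(x * v))) (Ioi 0) := by
  have := integrableOn_rpow_mul_exp_neg_mul_rpow (s := s) (p := 1) (b := x) hs one_pos hx
  simpa using this

lemma L4 (x : ℝ) (hx : 0 < x) :
    ‖BR x 1 - Complex.exp (x * Complex.I) * (((√(Real.pi / x) : ℝ) : ℂ) * BG 0)‖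
      ≤ (1 / x) ^ (3 / 2 : ℝ) * Real.Gamma (3 / 2) := by
  set k : ℝ → ℝ := fun v => v ^ (-(1 / 2) : ℝ) * Real.exp (-(x * v)) with hk
  have hkint : IntegrableOn k (Ioi 0) := int_aux_s19 x _ hx (by norm_num)
  have hkc : IntegrableOn (fun v => (k v : ℂ)) (Ioi 0) := hkint.ofReal
  have hK : ∫ v in Ioi (0:ℝ), k v = √(Real.pi / x) := by
    have := Real.integral_rpow_mul_exp_neg_mul_Ioi (a := 1 / 2) (r := x) (by norm_num) hx
    rw [Real.Gamma_one_half_eq, ← Real.sqrt_eq_rpow, ← Real.sqrt_mul (by positivity)] at this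
    rw [show Real.pi / x = 1 / x * Real.pi by ring, ← this]
    norm_num [hk]
  have hmeasG : Measurable BG := by unfold BG; fun_prop
  set G : ℝ → ℂ := (Ioc 0 1).indicator BG with hG
  have hGm : Measurable G := hmeasG.indicator measurableSet_Ioc
  have hGb : ∀ v, ‖G v‖ ≤ 1 := fun v => by
    rw [hG]; exact (norm_indicator_le_norm_self _ _).trans (BG_norm v)
  have hkG : IntegrableOn (fun v => (k v : ℂ) * G v) (Ioi 0) := by
    refine Integrable.mul_bdd (c := 1) hkc hGm.aestronglyMeasurable ?_
    exact Eventually.of_forall hGb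
  have hBR : BR x 1 = Complex.exp (x * Complex.I) * ∫ v in Ioi (0:ℝ), (k v : ℂ) * G v := by
    have e : ∀ v, (k v : ℂ) * G v = (Ioc 0 1).indicator (fun v => (k v : ℂ) * BG v) v := by
      intro v
      by_cases h : v ∈ Ioc (0:ℝ) 1 <;> simp [hG, h]
    simp_rw [e]
    rw [setIntegral_indicator measurableSet_Ioc, inter_eq_self_of_subset_right Ioc_subset_Ioi_self,
      ← integral_const_mul]
    unfold BR
    rw [intervalIntegral.integral_of_le zero_le_one]
    apply setIntegral_congr_fun measurableSet_Ioc
    intro v hv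
    exact BF_right x v hv.1
  have hmain : ((√(Real.pi / x) : ℝ) : ℂ) * BG 0 = ∫ v in Ioi (0:ℝ), (k v : ℂ) * BG 0 := by
    have hc : ∫ v in Ioi (0:ℝ), (k v : ℂ) = ((∫ v in Ioi (0:ℝ), k v : ℝ) : ℂ) := integral_ofReal
    rw [integral_mul_const, hc, hK]
  rw [hBR, hmain, ← mul_sub, ← integral_sub hkG (hkc.mul_const _), norm_mul,
    Complex.norm_exp_ofReal_mul_I, one_mul]
  have hG2 := Real.integral_rpow_mul_exp_neg_mul_Ioi (a := 3 / 2) (r := x) (by norm_num) hx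
  rw [← hG2]
  apply norm_integral_le_of_norm_le (int_aux_s19 x _ hx (by norm_num))
  refine (ae_restrict_mem measurableSet_Ioi).mono fun v hv => ?_
  have hv : 0 < v := hv
  have hk0 : 0 ≤ k v := by simp only [hk]; positivity
  rw [← mul_sub, norm_mul, Complex.norm_real, Real.norm_of_nonneg hk0]
  have hb : ‖G v - BG 0‖ ≤ v := by
    by_cases h : v ≤ 1
    · rw [hG, indicator_of_mem (show v ∈ Ioc (0:ℝ) 1 from ⟨hv, h⟩)]
      exact BG_lip v hv.le
    · rw [hG, indicator_of_notMem (fun hh => h hh.2), zero_sub, norm_neg]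
      linarith [BG_norm 0]
  have e : v ^ (3 / 2 - 1 : ℝ) = v ^ (-(1 / 2) : ℝ) * v := by
    rw [← Real.rpow_add_one hv.ne']; norm_num
  rw [e]
  calc _ ≤ k v * v := by gcongr
    _ = _ := by simp only [hk]; ring

lemma half (x : ℝ) : besselJ0 x
    = 2 / Real.pi * ∫ θ in (0:ℝ)..(Real.pi / 2), Real.cos (|x| * Real.sin θ) := by
  have hi : ∀ a b : ℝ, IntervalIntegrable (fun θ => Real.cos (|x| * Real.sin θ)) volume a b :=
    fun a b => by apply Continuous.intervalIntegrable; fun_prop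
  have e0 : ∀ θ, Real.cos (x * Real.sin θ) = Real.cos (|x| * Real.sin θ) := by
    intro θ
    rcases abs_choice x with h | h <;> rw [h]
    rw [neg_mul, Real.cos_neg]
  unfold besselJ0
  simp_rw [e0]
  rw [← intervalIntegral.integral_add_adjacent_intervals (hi 0 (Real.pi / 2)) (hi _ _)]
  have := intervalIntegral.integral_comp_sub_left (a := 0) (b := Real.pi / 2)
    (fun θ => Real.cos (|x| * Real.sin θ)) Real.pi
  simp only [Real.sin_pi_sub, sub_zero] at this
  rw [show Real.pi - Real.pi / 2 = Real.pi / 2 by ring] at this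
  rw [← this]; ring

lemma main1 (x : ℝ) (hx : 1 ≤ |x|) :
    |besselJ0 x - Real.sqrt (2 / (Real.pi * |x|)) * Real.cos (|x| - Real.pi / 4)| ≤
      (2 / Real.pi * (2 + Real.Gamma (3 / 2))) / |x| ^ ((3:ℝ) / 2) := by
  rw [half]
  generalize |x| = y at hx
  have hy : 0 < y := by linarith
  have hpi := Real.pi_pos
  have h3 := L3 y hy.le
  have h4 := L4 y hy
  set M : ℂ := Complex.exp (y * Complex.I) * (((√(Real.pi / y) : ℝ) : ℂ) * BG 0) with hM
  have h5 : |(Complex.I * BR y 1).re - (Complex.I * M).re|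
      ≤ (1 / y) ^ (3 / 2 : ℝ) * Real.Gamma (3 / 2) := by
    refine le_trans ?_ h4
    rw [← Complex.sub_re, ← mul_sub]
    refine (Complex.abs_re_le_norm _).trans ?_
    rw [norm_mul, Complex.norm_I, one_mul]
  have h6 : (Complex.I * M).re = -(√(Real.pi / y) * (1 / √2) * Real.cos (y - Real.pi / 4)) := by
    have : M = ((√(Real.pi / y) * (1 / √2) : ℝ) : ℂ)
        * Complex.exp ((y + Real.pi / 4 : ℝ) * Complex.I) := by
      rw [hM, BG_zero, Complex.ofReal_add, add_mul, Complex.exp_add, Complex.ofReal_mul]; ring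
    rw [this, Complex.I_mul_re, Complex.im_ofReal_mul, Complex.exp_ofReal_mul_I_im,
      ← Real.cos_pi_div_two_sub, ← Real.cos_neg]
    congr 3; ring
  have h7 : √(2 / (Real.pi * y)) = 2 / Real.pi * (√(Real.pi / y) * (1 / √2)) := by
    rw [Real.sqrt_eq_iff_mul_self_eq (by positivity) (by positivity)]
    have a1 : √(Real.pi / y) * √(Real.pi / y) = Real.pi / y := Real.mul_self_sqrt (by positivity)
    have a2 : (1 / √2) * (1 / √2) = 1 / 2 := by
      rw [div_mul_div_comm, Real.mul_self_sqrt (by norm_num)]; norm_num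
    symm
    calc _ = (2 / Real.pi) ^ 2 * ((√(Real.pi / y) * √(Real.pi / y)) * ((1 / √2) * (1 / √2))) := by
          ring
      _ = _ := by rw [a1, a2]; field_simp; try norm_num
  have h8 : Real.exp (-y) ≤ 2 * (1 / y) ^ (3 / 2 : ℝ) := by
    have q := Real.quadratic_le_exp_of_nonneg hy.le
    have r : y ^ (3 / 2 : ℝ) ≤ y ^ (2 : ℝ) := Real.rpow_le_rpow_of_exponent_le hx (by norm_num)
    rw [Real.rpow_two] at r
    have p : 0 < y ^ (3 / 2 : ℝ) := by positivity
    rw [Real.exp_neg, Real.div_rpow zero_le_one hy.le, Real.one_rpow, mul_one_div, inv_eq_one_div,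
      div_le_div_iff₀ (Real.exp_pos _) p]
    linarith
  rw [h7, mul_assoc, ← mul_sub, abs_mul, abs_of_pos (by positivity : 0 < 2 / Real.pi), mul_div_assoc]
  gcongr
  rw [h6] at h5
  have h9 : (2 + Real.Gamma (3 / 2)) / y ^ (3 / 2 : ℝ)
      = 2 * (1 / y) ^ (3 / 2 : ℝ) + (1 / y) ^ (3 / 2 : ℝ) * Real.Gamma (3 / 2) := by
    rw [Real.div_rpow zero_le_one hy.le, Real.one_rpow]; ring
  rw [h9, abs_le]
  rw [abs_le] at h3 h5
  constructor <;> linarith [h3.1, h3.2, h5.1, h5.2]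

lemma main2 (x : ℝ) : |besselJ0 x - 1| ≤ x ^ 2 := by
  have hpi := Real.pi_pos
  have e : besselJ0 x - 1
      = 1 / Real.pi * ∫ θ in (0:ℝ)..Real.pi, (Real.cos (x * Real.sin θ) - 1) := by
    rw [intervalIntegral.integral_sub (by apply Continuous.intervalIntegrable; fun_prop) (by simp)]
    unfold besselJ0
    simp
    field_simp
  have b := intervalIntegral.norm_integral_le_of_norm_le_const (a := 0) (b := Real.pi)
      (f := fun θ => Real.cos (x * Real.sin θ) - 1) (C := x ^ 2) (by
    intro θ _
    have h1 := Real.one_sub_sq_div_two_le_cos (x := x * Real.sin θ)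
    have h2 := Real.cos_le_one (x * Real.sin θ)
    have h3 := Real.sin_sq_le_one θ
    rw [Real.norm_eq_abs, abs_le]
    constructor <;> nlinarith [sq_nonneg x, mul_le_mul_of_nonneg_left h3 (sq_nonneg x)])
  rw [sub_zero, abs_of_pos hpi, Real.norm_eq_abs] at b
  rw [e, abs_mul, abs_of_pos (by positivity : 0 < 1 / Real.pi), one_div, inv_mul_le_iff₀ hpi]
  linarith

theorem J0_asymptotics :
    ∃ C > 0,
      (∀ x : ℝ, 1 ≤ |x| →
        |besselJ0 x - Real.sqrt (2 / (Real.pi * |x|)) * Real.cos (|x| - Real.pi / 4)| ≤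
          C / |x| ^ ((3:ℝ) / 2)) ∧
      ∀ x : ℝ, |x| ≤ 1 → |besselJ0 x - 1| ≤ x ^ 2 := by
  have hG : 0 < Real.Gamma (3 / 2) := Real.Gamma_pos_of_pos (by norm_num)
  have hpi := Real.pi_pos
  exact ⟨2 / Real.pi * (2 + Real.Gamma (3 / 2)), by positivity, fun x hx => main1 x hx,
    fun x _ => main2 x⟩
end
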